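/- arXiv:2312.05164 — 4 statements merged into one kernel-verified Lean document; each statement's English description precedes it below -/
import Mathlib

section
/- Let α₁, α₂ ∈ ℂ \ ℝ with {α₁, ᾱ₁} ∩ {α₂, ᾱ₂} = ∅, P₁, P₂ Hermitian projectors, and P̃ᵢ = φ Pᵢ φ⁻¹ with φ = (α₂ - ᾱ₁)I + (ᾱ₂ - α₂)P₂ + (ᾱ₁ - α₁)P₁. Then the refactorization identity g_{α₁,P₁}(z) g_{α₂,P₂}(z) = g_{α₂,P̃₂}(z) g_{α₁,P̃₁}(z) holds for all z outside {α₁, ᾱ₁, α₂, ᾱ₂}. -/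
open Matrix

/-- The simple element `g_{α,P}(z) = I + ((ᾱ-α)/(z-ᾱ)) P`. -/
noncomputable def simpleElt {n : ℕ} (α : ℂ) (P : Matrix (Fin n) (Fin n) ℂ) (z : ℂ) :
    Matrix (Fin n) (Fin n) ℂ :=
  1 + ((star α - α) / (z - star α)) • P

/-- A normal matrix with the eigenvalues `α` and `star α`, scaled by its adjoint. -/
lemma conjTranspose_mul_self_of_projection {n : ℕ} (α : ℂ) {P : Matrix (Fin n) (Fin n) ℂ}
    (hP : Pᴴ = P) (hP2 : P * P = P) :
    (α • (1 : Matrix (Fin n) (Fin n) ℂ) + (star α - α) • P)ᴴ * (α • 1 + (star α - α) • P)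
      = (star α * α) • 1 := by
  simp only [conjTranspose_add, conjTranspose_smul, conjTranspose_one, hP, star_sub, star_star,
    add_mul, mul_add, smul_mul_assoc, mul_smul_comm, one_mul, mul_one, hP2]
  module

/-- If two such matrices agree on a nonzero vector, then `α` and `β` have the same modulus. -/
lemma star_mul_self_eq_of_mulVec_eq {n : ℕ} {α β : ℂ} {P Q : Matrix (Fin n) (Fin n) ℂ}
    (hP : Pᴴ = P) (hP2 : P * P = P) (hQ : Qᴴ = Q) (hQ2 : Q * Q = Q)
    {v : Fin n → ℂ} (hv : v ≠ 0)
    (h : (α • (1 : Matrix (Fin n) (Fin n) ℂ) + (star α - α) • P) *ᵥ v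
      = (β • (1 : Matrix (Fin n) (Fin n) ℂ) + (star β - β) • Q) *ᵥ v) :
    star α * α = star β * β := by
  have norm_sq (γ : ℂ) {R : Matrix (Fin n) (Fin n) ℂ} (hR : Rᴴ = R) (hR2 : R * R = R) :
      star ((γ • (1 : Matrix (Fin n) (Fin n) ℂ) + (star γ - γ) • R) *ᵥ v) ⬝ᵥ
        ((γ • (1 : Matrix (Fin n) (Fin n) ℂ) + (star γ - γ) • R) *ᵥ v)
        = star γ * γ * (star v ⬝ᵥ v) := by
    rw [star_mulVec, ← dotProduct_mulVec, mulVec_mulVec,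
      conjTranspose_mul_self_of_projection γ hR hR2, smul_mulVec, one_mulVec, dotProduct_smul,
      smul_eq_mul]
  have hN : star v ⬝ᵥ v ≠ 0 := by
    open scoped ComplexOrder in
    exact fun h0 => hv (dotProduct_star_self_eq_zero.mp h0)
  apply mul_right_cancel₀ hN
  rw [← norm_sq α hP hP2, ← norm_sq β hQ hQ2, h]

lemma isUnit_det_of_projections {n : ℕ} {α β : ℂ} {P Q : Matrix (Fin n) (Fin n) ℂ}
    (hP : Pᴴ = P) (hP2 : P * P = P) (hQ : Qᴴ = Q) (hQ2 : Q * Q = Q)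
    (hne : α ≠ β) (hne' : α ≠ star β) :
    IsUnit ((α - star β) • (1 : Matrix (Fin n) (Fin n) ℂ)
      + (star α - α) • P + (star β - β) • Q).det := by
  rw [isUnit_iff_ne_zero]
  intro hdet
  obtain ⟨v, hv, hv0⟩ := exists_mulVec_eq_zero_iff.mpr hdet
  have modulus_eq (r : ℝ) :
      star (α - r) * (α - r) = star (star β - (r : ℂ)) * (star β - (r : ℂ)) := by
    refine star_mul_self_eq_of_mulVec_eq hP hP2 hQ hQ2 hv (sub_eq_zero.mp ?_)
    rw [← sub_mulVec, ← hv0]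
    congr 1
    have hr : star (r : ℂ) = r := Complex.conj_ofReal r
    simp only [star_sub, star_star, hr]
    module
  have h0 := congrArg Complex.re (modulus_eq 0)
  have h1 := congrArg Complex.re (modulus_eq 1)
  simp at h0 h1
  have hre : α.re = β.re := by linarith
  have him : (α.im - β.im) * (α.im + β.im) = 0 := by
    rw [hre] at h0
    linarith
  rcases mul_eq_zero.mp him with h | h
  · exact hne (Complex.ext hre (by linarith))
  · exact hne' (Complex.ext (by simpa using hre) (by simp; linarith))

lemma simpleElt_conj {n : ℕ} (α z : ℂ) (P : Matrix (Fin n) (Fin n) ℂ)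
    {φ : Matrix (Fin n) (Fin n) ℂ} (hφ : IsUnit φ.det) :
    simpleElt α (φ * P * φ⁻¹) z = φ * simpleElt α P z * φ⁻¹ := by
  simp [simpleElt, mul_add, add_mul, mul_nonsing_inv φ hφ]

lemma simpleElt_mul_intertwine {n : ℕ} {α β z : ℂ} {P Q : Matrix (Fin n) (Fin n) ℂ}
    (hP2 : P * P = P) (hQ2 : Q * Q = Q) (hα : z ≠ star α) (hβ : z ≠ star β) :
    simpleElt α P z * simpleElt β Q z *
        ((β - star α) • 1 + (star β - β) • Q + (star α - α) • P)
      = ((β - star α) • 1 + (star β - β) • Q + (star α - α) • P) *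
        (simpleElt β Q z * simpleElt α P z) := by
  have hα' : z - star α ≠ 0 := sub_ne_zero.mpr hα
  have hβ' : z - star β ≠ 0 := sub_ne_zero.mpr hβ
  have hQQ (M : Matrix (Fin n) (Fin n) ℂ) : Q * (Q * M) = Q * M := by rw [← mul_assoc, hQ2]
  simp only [simpleElt, add_mul, mul_add, smul_mul_assoc, mul_smul_comm, one_mul, mul_one,
    mul_assoc, hP2, hQ2, hQQ]
  match_scalars <;> field_simp <;> ring

/-- Refactorization identity
`g_{α₁,P₁}(z) g_{α₂,P₂}(z) = g_{α₂,P̃₂}(z) g_{α₁,P̃₁}(z)` with `P̃ᵢ = φ Pᵢ φ⁻¹`. -/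
theorem refactorization_identity {n : ℕ} (α₁ α₂ : ℂ)
    (hα₁ : α₁.im ≠ 0) (hα₂ : α₂.im ≠ 0)
    (hgen : ({α₁, star α₁} : Set ℂ) ∩ {α₂, star α₂} = ∅)
    (P₁ P₂ : Matrix (Fin n) (Fin n) ℂ)
    (hP₁ : P₁ᴴ = P₁) (hP₁2 : P₁ * P₁ = P₁)
    (hP₂ : P₂ᴴ = P₂) (hP₂2 : P₂ * P₂ = P₂)
    (φ : Matrix (Fin n) (Fin n) ℂ)
    (hφ : φ = (α₂ - star α₁) • (1 : Matrix (Fin n) (Fin n) ℂ)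
      + (star α₂ - α₂) • P₂ + (star α₁ - α₁) • P₁)
    (z : ℂ) (hz : z ∉ ({α₁, star α₁, α₂, star α₂} : Set ℂ)) :
    simpleElt α₁ P₁ z * simpleElt α₂ P₂ z
      = simpleElt α₂ (φ * P₂ * φ⁻¹) z * simpleElt α₁ (φ * P₁ * φ⁻¹) z := by
  have hne (w : ℂ) (h₁ : w ∈ ({α₁, star α₁} : Set ℂ)) : α₂ ≠ w := by
    rintro rfl
    exact (Set.ext_iff.mp hgen α₂).mp ⟨h₁, by simp⟩
  have hdet : IsUnit φ.det :=
    hφ ▸ isUnit_det_of_projections hP₂ hP₂2 hP₁ hP₁2 (hne _ (by simp)) (hne _ (by simp))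
  simp only [Set.mem_insert_iff, Set.mem_singleton_iff, not_or] at hz
  have key : simpleElt α₁ P₁ z * simpleElt α₂ P₂ z * φ
      = φ * (simpleElt α₂ P₂ z * simpleElt α₁ P₁ z) :=
    hφ ▸ simpleElt_mul_intertwine hP₁2 hP₂2 hz.2.1 hz.2.2.2
  rw [simpleElt_conj _ _ _ hdet, simpleElt_conj _ _ _ hdet]
  calc simpleElt α₁ P₁ z * simpleElt α₂ P₂ z
      = simpleElt α₁ P₁ z * simpleElt α₂ P₂ z * φ * φ⁻¹ := by
        rw [mul_nonsing_inv_cancel_right _ _ hdet]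
    _ = φ * simpleElt α₂ P₂ z * (φ⁻¹ * φ) * simpleElt α₁ P₁ z * φ⁻¹ := by
        rw [key, nonsing_inv_mul φ hdet, mul_one, ← mul_assoc]
    _ = _ := by simp only [mul_assoc]
end

section
/- Let U be a Hermitian unitary matrix, α ∈ ℂ \ (ℝ ∪ iℝ), and define the map B(α) on Hermitian projectors by B(α)(P) = U φ P φ⁻¹ U*, where φ = 2αI + (ᾱ - α)(P + UPU*). Then B(-ᾱ)(B(α)(P)) = P for every Hermitian projector P; that is, the map (α, P) ↦ (-ᾱ, B(α)(P)) is an involution. -/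
open Matrix

/-- The parametric reflection map at the level of projectors:
`B(α)(P) = U φ P φ⁻¹ U*` with `φ = 2αI + (ᾱ-α)(P + UPU*)`. -/
noncomputable def Bmap {n : ℕ} (U : Matrix (Fin n) (Fin n) ℂ) (α : ℂ)
    (P : Matrix (Fin n) (Fin n) ℂ) : Matrix (Fin n) (Fin n) ℂ :=
  let φ : Matrix (Fin n) (Fin n) ℂ :=
    (2 * α) • 1 + (star α - α) • (P + U * P * Uᴴ)
  U * (φ * P * φ⁻¹) * Uᴴ

namespace Matrix

theorem isUnit_det_of_add_conjTranspose_eq_smul_one {m : Type*} [Fintype m] [DecidableEq m]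
    {M : Matrix m m ℂ} {r : ℂ} (hr : r ≠ 0) (h : M + Mᴴ = r • 1) : IsUnit M.det := by
  rw [isUnit_iff_ne_zero]
  intro hdet
  obtain ⟨v, hv, hMv⟩ := exists_mulVec_eq_zero_iff.mpr hdet
  have hadj : star v ⬝ᵥ (Mᴴ *ᵥ v) = 0 := by
    rw [dotProduct_mulVec, ← star_mulVec, hMv, star_zero, zero_dotProduct]
  have key : star v ⬝ᵥ ((M + Mᴴ) *ᵥ v) = 0 := by
    rw [add_mulVec, dotProduct_add, hadj, hMv, dotProduct_zero, add_zero]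
  rw [h, smul_mulVec, one_mulVec, dotProduct_smul, smul_eq_mul] at key
  rcases mul_eq_zero.mp key with h0 | h0
  · exact hr h0
  · open scoped ComplexOrder in
    exact hv (dotProduct_star_self_eq_zero.mp h0)

theorem isUnit_det_smul_one_add_smul {m : Type*} [Fintype m] [DecidableEq m]
    {S : Matrix m m ℂ} (hS : Sᴴ = S) {a c : ℂ} (ha : a.re ≠ 0) (hc : star c = -c) :
    IsUnit (a • 1 + c • S).det := by
  refine isUnit_det_of_add_conjTranspose_eq_smul_one (r := a + star a) ?_ ?_
  · intro h
    have := congrArg Complex.re h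
    simp at this
    exact ha (by linarith)
  · rw [conjTranspose_add, conjTranspose_smul, conjTranspose_smul, hS, hc, conjTranspose_one]
    module

theorem mul_mul_inv_of_commute {m : Type*} [Fintype m] [DecidableEq m]
    {A B : Matrix m m ℂ} (hA : IsUnit A.det) (h : Commute A B) : A * B * A⁻¹ = B := by
  rw [h.eq, mul_nonsing_inv_cancel_right _ _ hA]

end Matrix

/-- For idempotents `P` and `Q`, the element `(P + Q)² - 2 (P + Q)` commutes with `P`. -/
theorem commute_add_sq_sub_two_smul {R : Type*} [Ring R] {P Q : R} (hP : P * P = P)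
    (hQ : Q * Q = Q) : Commute ((P + Q) * (P + Q) - ((P + Q) + (P + Q))) P := by
  have h : (P + Q) * (P + Q) - ((P + Q) + (P + Q)) = P * Q + Q * P - P - Q := by
    rw [add_mul, mul_add, mul_add, hP, hQ]
    abel
  have h1 : P * (P * Q) = P * Q := by rw [← mul_assoc, hP]
  rw [h, commute_iff_eq]
  simp only [sub_mul, add_mul, mul_sub, mul_add, mul_assoc, hP, h1]
  abel

/-- `B(-ᾱ) ∘ B(α) = id` on Hermitian projectors: the parametric reflection map is
an involution `(α, P) ↦ (-ᾱ, B(α)(P))`. -/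
theorem Bmap_involution {n : ℕ} (U : Matrix (Fin n) (Fin n) ℂ)
    (hUnit : Uᴴ * U = 1) (hHerm : Uᴴ = U)
    (α : ℂ) (hre : α.re ≠ 0) (him : α.im ≠ 0)
    (P : Matrix (Fin n) (Fin n) ℂ) (hP : Pᴴ = P) (hP2 : P * P = P) :
    Bmap U (-(star α)) (Bmap U α P) = P := by
  have hUU : U * U = 1 := by rwa [hHerm] at hUnit
  have hUUX (X : Matrix (Fin n) (Fin n) ℂ) : U * (U * X) = X := by
    rw [← Matrix.mul_assoc, hUU, Matrix.one_mul]
  simp only [Bmap, hHerm]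
  set Q := U * P * U with hQdef
  have hQ : Qᴴ = Q := by
    simp [hQdef, conjTranspose_mul, hHerm, hP, Matrix.mul_assoc]
  have hQ2 : Q * Q = Q := by
    simp only [hQdef, Matrix.mul_assoc, hUUX]
    rw [← Matrix.mul_assoc P P, hP2]
  have hUPU : U * P = Q * U := by
    rw [hQdef, Matrix.mul_assoc, hUU, Matrix.mul_one]
  have hUQ : U * Q = P * U := by
    rw [hQdef, Matrix.mul_assoc, hUUX]
  set c := star α - α with hc
  have hcs : star c = -c := by rw [hc, star_sub, star_star, neg_sub]
  have hS : (P + Q)ᴴ = P + Q := by rw [conjTranspose_add, hP, hQ]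
  set φ : Matrix (Fin n) (Fin n) ℂ := (2 * α) • 1 + c • (P + Q) with hφ
  have hc' : star (-star α) - -star α = c := by
    rw [star_neg, star_star, hc]; ring
  have hφu : IsUnit φ.det := isUnit_det_smul_one_add_smul hS (by simpa using hre) hcs
  have hφS : Commute φ (P + Q) :=
    ((Commute.one_left _).smul_left _).add_left ((Commute.refl _).smul_left _)
  have hφU : Commute φ U := by
    refine ((Commute.one_left _).smul_left _).add_left (Commute.smul_left ?_ _)
    rw [commute_iff_eq, Matrix.add_mul, Matrix.mul_add, hUPU, hUQ, add_comm]
  have hφiU : Commute φ⁻¹ U := by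
    rw [commute_iff_eq]
    calc φ⁻¹ * U = φ⁻¹ * (U * φ) * φ⁻¹ := by
          rw [Matrix.mul_assoc, mul_nonsing_inv_cancel_right _ _ hφu]
      _ = U * φ⁻¹ := by
          rw [← hφU.eq, nonsing_inv_mul_cancel_left _ _ hφu]
  have hP1 : U * (φ * P * φ⁻¹) * U = φ * Q * φ⁻¹ := by
    rw [Matrix.mul_assoc, Matrix.mul_assoc _ φ⁻¹, hφiU.eq, ← Matrix.mul_assoc,
      ← Matrix.mul_assoc, ← Matrix.mul_assoc, ← hφU.eq, hQdef]
    simp only [Matrix.mul_assoc]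
  have hP2' : U * (φ * Q * φ⁻¹) * U = φ * P * φ⁻¹ := by
    rw [← hP1]
    simp only [Matrix.mul_assoc, hUUX, hUU, Matrix.mul_one]
  have hsum : φ * Q * φ⁻¹ + φ * P * φ⁻¹ = P + Q := by
    rw [← Matrix.add_mul, ← Matrix.mul_add, add_comm Q P, mul_mul_inv_of_commute hφu hφS]
  rw [hP1, hP2', hsum, hc']
  set ψ : Matrix (Fin n) (Fin n) ℂ := (2 * -star α) • 1 + c • (P + Q) with hψ
  have hψu : IsUnit ψ.det := isUnit_det_smul_one_add_smul hS (by simpa using hre) hcs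
  have hψφ : ψ * φ = (-(4 * star α * α)) • 1
      + (c * c) • ((P + Q) * (P + Q) - ((P + Q) + (P + Q))) := by
    rw [hψ, hφ]
    simp only [Matrix.add_mul _ _ ((2 * α) • (1 : Matrix (Fin n) (Fin n) ℂ) + c • (P + Q)),
      Matrix.mul_add ((2 * -star α) • (1 : Matrix (Fin n) (Fin n) ℂ)),
      Matrix.mul_add (c • (P + Q)) ((2 * α) • 1), Matrix.smul_mul, Matrix.mul_smul,
      Matrix.one_mul, Matrix.mul_one]
    rw [hc]
    module
  have hcomm : Commute (ψ * φ) Q := by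
    rw [hψφ]
    refine ((Commute.one_left _).smul_left _).add_left (Commute.smul_left ?_ _)
    rw [add_comm P Q]
    exact commute_add_sq_sub_two_smul hQ2 hP2
  have hu : IsUnit (ψ * φ).det := by
    rw [det_mul]
    exact hψu.mul hφu
  have hfix : ψ * (φ * Q * φ⁻¹) * ψ⁻¹ = Q := by
    have h := mul_mul_inv_of_commute hu hcomm
    rw [Matrix.mul_inv_rev] at h
    simpa only [Matrix.mul_assoc] using h
  rw [hfix, hUQ, Matrix.mul_assoc, hUU, Matrix.mul_one]
end

section
/- For nonzero p ∈ ℂⁿ, let π_[p] = pp*/(p*p). Let U be Hermitian unitary, α ∈ ℂ \ (ℝ ∪ iℝ). Define B̃(α)([p]) = [(I + ((ᾱ − α)/(α + ᾱ)) π_[p]) U p] as a point of ℂℙⁿ⁻¹. Then B̃(−ᾱ)(B̃(α)([p])) = [p]; i.e., the rank-one parametric reflection map satisfies B̃(τ(α)) ∘ B̃(α) = id with τ(α) = −ᾱ. -/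
open Matrix

/-- The orthogonal projector `π_[p] = pp*/(p*p)` onto the line through `p`. -/
noncomputable def lineProj {n : ℕ} (p : Fin n → ℂ) : Matrix (Fin n) (Fin n) ℂ :=
  (star p ⬝ᵥ p)⁻¹ • Matrix.vecMulVec p (star p)

/-- The rank-one reflection map at the level of vectors:
`p ↦ (I + ((ᾱ-α)/(α+ᾱ)) π_[p]) U p`. -/
noncomputable def BtildeVec {n : ℕ} (U : Matrix (Fin n) (Fin n) ℂ) (α : ℂ)
    (p : Fin n → ℂ) : Fin n → ℂ :=
  ((1 : Matrix (Fin n) (Fin n) ℂ)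
    + ((star α - α) / (α + star α)) • lineProj p) *ᵥ (U *ᵥ p)

/-- The reflection map in coordinates: `U p` shifted along `p`. -/
theorem BtildeVec_eq_add_smul {n : ℕ} (U : Matrix (Fin n) (Fin n) ℂ) (α : ℂ) (p : Fin n → ℂ) :
    BtildeVec U α p = U *ᵥ p +
      ((star α - α) / (α + star α) * ((star p ⬝ᵥ U *ᵥ p) / (star p ⬝ᵥ p))) • p := by
  ext i
  simp only [BtildeVec, lineProj, add_mulVec, one_mulVec, smul_mulVec, vecMulVec_mulVec,
    Pi.add_apply, Pi.smul_apply, smul_eq_mul, MulOpposite.smul_eq_mul_unop, MulOpposite.unop_op]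
  ring

/-- The quadratic form of a Hermitian matrix is real. -/
theorem star_dotProduct_mulVec_of_conjTranspose_eq {n : ℕ} {U : Matrix (Fin n) (Fin n) ℂ}
    (hU : Uᴴ = U) (p : Fin n → ℂ) : star (star p ⬝ᵥ U *ᵥ p) = star p ⬝ᵥ U *ᵥ p := by
  rw [← star_dotProduct, star_mulVec, hU, dotProduct_mulVec]

/-- `1 - t² = 1 + |t|²` for purely imaginary `t`. -/
theorem one_sub_sq_ne_zero_of_star_eq_neg {t : ℂ} (ht : star t = -t) : 1 - t ^ 2 ≠ 0 := by
  have h : 1 - t ^ 2 = ((1 + Complex.normSq t : ℝ) : ℂ) := by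
    push_cast
    rw [Complex.normSq_eq_conj_mul_self, starRingEnd_apply, ht]
    ring
  rw [h, Complex.ofReal_ne_zero]
  have := Complex.normSq_nonneg t
  positivity

/-- `B̃(-ᾱ) ∘ B̃(α) = id` on `ℂℙⁿ⁻¹`: applying the rank-one reflection map with
parameter `α` and then with `-ᾱ` returns a nonzero multiple of the original vector. -/
theorem BtildeVec_involution {n : ℕ} (U : Matrix (Fin n) (Fin n) ℂ)
    (hUnit : Uᴴ * U = 1) (hHerm : Uᴴ = U)
    (α : ℂ) (hre : α.re ≠ 0) (him : α.im ≠ 0)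
    (p : Fin n → ℂ) (hp : p ≠ 0) :
    ∃ c : ℂ, c ≠ 0 ∧ BtildeVec U (-(star α)) (BtildeVec U α p) = c • p := by
  have hUU (v : Fin n → ℂ) : U *ᵥ (U *ᵥ v) = v := by
    rw [mulVec_mulVec, show U * U = 1 by rwa [hHerm] at hUnit, one_mulVec]
  have hNreal : star (star p ⬝ᵥ p) = star p ⬝ᵥ p := (star_dotProduct p p).symm
  have hhreal := star_dotProduct_mulVec_of_conjTranspose_eq hHerm p
  have hadj (v : Fin n → ℂ) : star (U *ᵥ p) ⬝ᵥ v = star p ⬝ᵥ U *ᵥ v := by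
    rw [star_mulVec, hHerm, dotProduct_mulVec]
  set k : ℂ := (star α - α) / (α + star α) with hk
  have hkstar : star k = -k := by
    rw [hk, star_div₀, star_sub, star_add, star_star, add_comm (star α), ← neg_div, neg_sub]
  have hkneg : (star (-star α) - -star α) / (-star α + star (-star α)) = -k := by
    rw [hk, star_neg, star_star, ← div_neg]
    congr 1 <;> ring
  set N := star p ⬝ᵥ p
  set h := star p ⬝ᵥ U *ᵥ p
  set t := k * (h / N) with ht
  have htstar : star t = -t := by
    rw [ht, star_mul', hkstar, star_div₀, hhreal, hNreal, neg_mul]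
  have hc := one_sub_sq_ne_zero_of_star_eq_neg htstar
  have hq : BtildeVec U α p = U *ᵥ p + t • p := BtildeVec_eq_add_smul U α p
  have hUq : U *ᵥ (U *ᵥ p + t • p) = p + t • U *ᵥ p := by
    rw [mulVec_add, mulVec_smul, hUU]
  have hqq : star (U *ᵥ p + t • p) ⬝ᵥ (U *ᵥ p + t • p) = (1 - t ^ 2) * N := by
    simp only [star_add, star_smul, htstar, add_dotProduct, dotProduct_add, smul_dotProduct,
      dotProduct_smul, hadj, hUU, smul_eq_mul]
    ring
  have hqUq : star (U *ᵥ p + t • p) ⬝ᵥ (p + t • U *ᵥ p) = (1 - t ^ 2) * h := by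
    simp only [star_add, star_smul, htstar, add_dotProduct, dotProduct_add, smul_dotProduct,
      dotProduct_smul, hadj, hUU, smul_eq_mul]
    ring
  refine ⟨1 - t ^ 2, hc, ?_⟩
  rw [hq, BtildeVec_eq_add_smul, hkneg, hUq, hqq, hqUq, mul_div_mul_left _ _ hc, neg_mul, ← ht]
  module
end

section
/- Let α₁, α₂, α₃ ∈ ℂ \ ℝ be pairwise 'generic' ({αᵢ, ᾱᵢ} ∩ {αⱼ, ᾱⱼ} = ∅ for i ≠ j), and let R(αᵢ,αⱼ) be the refactorization Yang–Baxter maps on pairs of Hermitian projectors given by Pᵢ ↦ φPᵢφ⁻¹ with φ = (αⱼ−ᾱᵢ)I + (ᾱⱼ−αⱼ)Pⱼ + (ᾱᵢ−αᵢ)Pᵢ. Then R₁₂(α₁,α₂)R₁₃(α₁,α₃)R₂₃(α₂,α₃) = R₂₃(α₂,α₃)R₁₃(α₁,α₃)R₁₂(α₁,α₂) as maps on triples of Hermitian projectors. -/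
open Matrix

/-- The refactorization matrix `φ = (α₂-ᾱ₁)I + (ᾱ₂-α₂)P₂ + (ᾱ₁-α₁)P₁`. -/
noncomputable def phiMat {n : ℕ} (α₁ α₂ : ℂ) (P₁ P₂ : Matrix (Fin n) (Fin n) ℂ) :
    Matrix (Fin n) (Fin n) ℂ :=
  (α₂ - star α₁) • 1 + (star α₂ - α₂) • P₂ + (star α₁ - α₁) • P₁

/-- The Yang–Baxter map `R(α₁,α₂)(P₁,P₂) = (φP₁φ⁻¹, φP₂φ⁻¹)`. -/
noncomputable def Rpair {n : ℕ} (α₁ α₂ : ℂ)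
    (P₁ P₂ : Matrix (Fin n) (Fin n) ℂ) :
    Matrix (Fin n) (Fin n) ℂ × Matrix (Fin n) (Fin n) ℂ :=
  (phiMat α₁ α₂ P₁ P₂ * P₁ * (phiMat α₁ α₂ P₁ P₂)⁻¹,
   phiMat α₁ α₂ P₁ P₂ * P₂ * (phiMat α₁ α₂ P₁ P₂)⁻¹)

/-- `R₁₂` acting on triples. -/
noncomputable def R12 {n : ℕ} (α₁ α₂ : ℂ)
    (t : Matrix (Fin n) (Fin n) ℂ × Matrix (Fin n) (Fin n) ℂ × Matrix (Fin n) (Fin n) ℂ) :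
    Matrix (Fin n) (Fin n) ℂ × Matrix (Fin n) (Fin n) ℂ × Matrix (Fin n) (Fin n) ℂ :=
  ((Rpair α₁ α₂ t.1 t.2.1).1, (Rpair α₁ α₂ t.1 t.2.1).2, t.2.2)

/-- `R₁₃` acting on triples. -/
noncomputable def R13 {n : ℕ} (α₁ α₃ : ℂ)
    (t : Matrix (Fin n) (Fin n) ℂ × Matrix (Fin n) (Fin n) ℂ × Matrix (Fin n) (Fin n) ℂ) :
    Matrix (Fin n) (Fin n) ℂ × Matrix (Fin n) (Fin n) ℂ × Matrix (Fin n) (Fin n) ℂ :=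
  ((Rpair α₁ α₃ t.1 t.2.2).1, t.2.1, (Rpair α₁ α₃ t.1 t.2.2).2)

/-- `R₂₃` acting on triples. -/
noncomputable def R23 {n : ℕ} (α₂ α₃ : ℂ)
    (t : Matrix (Fin n) (Fin n) ℂ × Matrix (Fin n) (Fin n) ℂ × Matrix (Fin n) (Fin n) ℂ) :
    Matrix (Fin n) (Fin n) ℂ × Matrix (Fin n) (Fin n) ℂ × Matrix (Fin n) (Fin n) ℂ :=
  (t.1, (Rpair α₂ α₃ t.2.1 t.2.2).1, (Rpair α₂ α₃ t.2.1 t.2.2).2)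

section RefactorizationMaps

variable {n : ℕ}

/-- Hermitian projectors. -/
def IsHermProj (P : Matrix (Fin n) (Fin n) ℂ) : Prop := Pᴴ = P ∧ P * P = P

/-- The simple element `g_{α,P}(z)` multiplied by its denominator `z - ᾱ`. -/
noncomputable def simpleElem (α : ℂ) (P : Matrix (Fin n) (Fin n) ℂ) (z : ℂ) :
    Matrix (Fin n) (Fin n) ℂ :=
  (z - star α) • 1 + (star α - α) • P

lemma simpleElem_mul_simpleElem_mul_phiMat (α₁ α₂ z : ℂ) {P₁ P₂ : Matrix (Fin n) (Fin n) ℂ}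
    (h₁ : P₁ * P₁ = P₁) (h₂ : P₂ * P₂ = P₂) :
    simpleElem α₁ P₁ z * simpleElem α₂ P₂ z * phiMat α₁ α₂ P₁ P₂
      = phiMat α₁ α₂ P₁ P₂ * (simpleElem α₂ P₂ z * simpleElem α₁ P₁ z) := by
  have h₂' : ∀ X, P₂ * (P₂ * X) = P₂ * X := fun X => by rw [← mul_assoc, h₂]
  simp only [simpleElem, phiMat, add_mul, mul_add, smul_mul_assoc, mul_smul_comm, one_mul, mul_one,
    mul_assoc, h₁, h₂, h₂']
  module

lemma conjTranspose_phiMat (α₁ α₂ : ℂ) {P₁ P₂ : Matrix (Fin n) (Fin n) ℂ}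
    (h₁ : IsHermProj P₁) (h₂ : IsHermProj P₂) :
    (phiMat α₁ α₂ P₁ P₂)ᴴ
      = (star α₂ - α₁) • 1 + (α₂ - star α₂) • P₂ + (α₁ - star α₁) • P₁ := by
  simp [phiMat, h₁.1, h₂.1]

lemma commute_left_phiMat (α₁ α₂ : ℂ) {P₁ P₂ : Matrix (Fin n) (Fin n) ℂ}
    (h₁ : IsHermProj P₁) (h₂ : IsHermProj P₂) :
    Commute P₁ ((phiMat α₁ α₂ P₁ P₂)ᴴ * phiMat α₁ α₂ P₁ P₂) := by
  have h₁' : ∀ X, P₁ * (P₁ * X) = P₁ * X := fun X => by rw [← mul_assoc, h₁.2]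
  rw [conjTranspose_phiMat α₁ α₂ h₁ h₂, Commute, SemiconjBy]
  simp only [phiMat, add_mul, mul_add, smul_mul_assoc, mul_smul_comm, one_mul, mul_one,
    mul_assoc, h₁.2, h₂.2, h₁']
  module

lemma commute_right_phiMat (α₁ α₂ : ℂ) {P₁ P₂ : Matrix (Fin n) (Fin n) ℂ}
    (h₁ : IsHermProj P₁) (h₂ : IsHermProj P₂) :
    Commute P₂ ((phiMat α₁ α₂ P₁ P₂)ᴴ * phiMat α₁ α₂ P₁ P₂) := by
  have h₂' : ∀ X, P₂ * (P₂ * X) = P₂ * X := fun X => by rw [← mul_assoc, h₂.2]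
  rw [conjTranspose_phiMat α₁ α₂ h₁ h₂, Commute, SemiconjBy]
  simp only [phiMat, add_mul, mul_add, smul_mul_assoc, mul_smul_comm, one_mul, mul_one,
    mul_assoc, h₁.2, h₂.2, h₂']
  module

lemma IsHermProj.conj {P F : Matrix (Fin n) (Fin n) ℂ} (hP : IsHermProj P) (hF : IsUnit F.det)
    (hc : Commute P (Fᴴ * F)) : IsHermProj (F * P * F⁻¹) := by
  have hF' : IsUnit Fᴴ.det := by rw [det_conjTranspose]; exact hF.star
  refine ⟨?_, ?_⟩
  · rw [conjTranspose_mul, conjTranspose_mul, hP.1, conjTranspose_nonsing_inv]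
    calc Fᴴ⁻¹ * (P * Fᴴ) = Fᴴ⁻¹ * (P * (Fᴴ * F)) * F⁻¹ := by
          simp only [mul_assoc, mul_nonsing_inv _ hF, mul_one]
      _ = F * P * F⁻¹ := by
          rw [hc.eq, mul_assoc Fᴴ, nonsing_inv_mul_cancel_left _ _ hF']
  · calc F * P * F⁻¹ * (F * P * F⁻¹) = F * P * (F⁻¹ * F) * P * F⁻¹ := by simp only [mul_assoc]
      _ = F * P * F⁻¹ := by rw [nonsing_inv_mul _ hF, mul_one, mul_assoc F, hP.2]

lemma simpleElem_conj (α z : ℂ) (P : Matrix (Fin n) (Fin n) ℂ) {F : Matrix (Fin n) (Fin n) ℂ}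
    (hF : IsUnit F.det) : simpleElem α (F * P * F⁻¹) z = F * simpleElem α P z * F⁻¹ := by
  simp [simpleElem, mul_add, add_mul, mul_nonsing_inv _ hF]

/-- The sets `{α, star α}` and `{β, star β}` are disjoint. -/
def IsGeneric (α β : ℂ) : Prop := ({α, star α} : Set ℂ) ∩ {β, star β} = ∅

lemma IsGeneric.symm {α β : ℂ} (h : IsGeneric α β) : IsGeneric β α := by
  rwa [IsGeneric, Set.inter_comm]

lemma IsGeneric.ne {α β : ℂ} (h : IsGeneric α β) : α ≠ β := by
  rintro rfl
  exact (Set.eq_empty_iff_forall_notMem.mp h α) (by simp)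

lemma IsGeneric.ne_star {α β : ℂ} (h : IsGeneric α β) : α ≠ star β := by
  intro e
  exact (Set.eq_empty_iff_forall_notMem.mp h α) (by simp [← e])

lemma isUnit_simpleElem {α z : ℂ} (h : IsGeneric z α) {P : Matrix (Fin n) (Fin n) ℂ}
    (hP : P * P = P) : IsUnit (simpleElem α P z) := by
  have h0 : (z - star α) * (z - α) ≠ 0 :=
    mul_ne_zero (sub_ne_zero.mpr h.ne_star) (sub_ne_zero.mpr h.ne)
  have key : simpleElem α P z * ((z - α) • 1 - (star α - α) • P)
      = ((z - star α) * (z - α)) • 1 := by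
    simp only [simpleElem, add_mul, mul_sub, smul_mul_assoc, mul_smul_comm, one_mul, mul_one, hP]
    module
  refine IsUnit.of_mul_eq_one
    (((z - star α) * (z - α))⁻¹ • ((z - α) • 1 - (star α - α) • P)) ?_
  rw [mul_smul_comm, key, smul_smul, inv_mul_cancel₀ h0, one_smul]

open scoped ComplexOrder in
lemma isUnit_det_phiMat {α₁ α₂ : ℂ} (h : IsGeneric α₁ α₂) {P₁ P₂ : Matrix (Fin n) (Fin n) ℂ}
    (h₁ : IsHermProj P₁) (h₂ : IsHermProj P₂) : IsUnit (phiMat α₁ α₂ P₁ P₂).det := by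
  rw [isUnit_iff_ne_zero]
  intro hdet
  obtain ⟨v, hv, hφ⟩ := exists_mulVec_eq_zero_iff.mpr hdet
  -- `φ = B - A` with `A`, `B` normal with spectra `{α₁, ᾱ₁}` and `{α₂, ᾱ₂}`.
  have aux : ∀ (α : ℂ) (P : Matrix (Fin n) (Fin n) ℂ), IsHermProj P →
      ∀ w, (star α • 1 + (α - star α) • P) *ᵥ v = w →
        star v ⬝ᵥ w + star w ⬝ᵥ v = (α + star α) * (star v ⬝ᵥ v) ∧
          star w ⬝ᵥ w = (α * star α) * (star v ⬝ᵥ v) := by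
    rintro α P hP w rfl
    have hA : (star α • 1 + (α - star α) • P)ᴴ = α • 1 + (star α - α) • P := by
      simp [hP.1]
    constructor
    · rw [star_mulVec, hA, ← dotProduct_mulVec, ← dotProduct_add, ← add_mulVec,
        show (star α • 1 + (α - star α) • P) + (α • 1 + (star α - α) • P)
          = (α + star α) • (1 : Matrix (Fin n) (Fin n) ℂ) by module]
      simp [smul_mulVec]
    · rw [star_mulVec, hA, ← dotProduct_mulVec, mulVec_mulVec,
        show (α • 1 + (star α - α) • P) * (star α • 1 + (α - star α) • P)
          = (α * star α) • (1 : Matrix (Fin n) (Fin n) ℂ) by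
          simp only [add_mul, mul_add, smul_mul_assoc, mul_smul_comm, one_mul, mul_one, hP.2]
          module]
      simp [smul_mulVec]
  have hAB : (star (star α₂) • 1 + (star α₂ - star (star α₂)) • P₂) *ᵥ v
      = (star α₁ • 1 + (α₁ - star α₁) • P₁) *ᵥ v := by
    rw [← sub_eq_zero, ← sub_mulVec, ← hφ, star_star]
    congr 1
    simp only [phiMat]
    module
  obtain ⟨t₁, n₁⟩ := aux α₁ P₁ h₁ _ rfl
  obtain ⟨t₂, n₂⟩ := aux (star α₂) P₂ h₂ _ hAB
  have hs : star v ⬝ᵥ v ≠ 0 := fun e => hv (dotProduct_star_self_eq_zero.mp e)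
  have ht := mul_right_cancel₀ hs (t₁.symm.trans t₂)
  have hn := mul_right_cancel₀ hs (n₁.symm.trans n₂)
  rw [star_star] at ht hn
  have : (α₁ - α₂) * (α₁ - star α₂) = 0 := by linear_combination α₁ * ht - hn
  exact mul_ne_zero (sub_ne_zero.mpr h.ne) (sub_ne_zero.mpr h.ne_star) this

lemma Rpair_spec {α₁ α₂ : ℂ} (h : IsGeneric α₁ α₂) {P₁ P₂ : Matrix (Fin n) (Fin n) ℂ}
    (h₁ : IsHermProj P₁) (h₂ : IsHermProj P₂) :
    IsHermProj (Rpair α₁ α₂ P₁ P₂).1 ∧ IsHermProj (Rpair α₁ α₂ P₁ P₂).2 ∧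
      ∀ z, simpleElem α₁ P₁ z * simpleElem α₂ P₂ z
        = simpleElem α₂ (Rpair α₁ α₂ P₁ P₂).2 z * simpleElem α₁ (Rpair α₁ α₂ P₁ P₂).1 z := by
  have hF := isUnit_det_phiMat h h₁ h₂
  refine ⟨h₁.conj hF (commute_left_phiMat α₁ α₂ h₁ h₂),
    h₂.conj hF (commute_right_phiMat α₁ α₂ h₁ h₂), fun z => ?_⟩
  have key := simpleElem_mul_simpleElem_mul_phiMat α₁ α₂ z h₁.2 h₂.2
  simp only [Rpair]
  rw [simpleElem_conj _ _ _ hF, simpleElem_conj _ _ _ hF]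
  generalize phiMat α₁ α₂ P₁ P₂ = F at hF key
  calc _ = simpleElem α₁ P₁ z * simpleElem α₂ P₂ z * F * F⁻¹ := by
        rw [mul_nonsing_inv_cancel_right _ _ hF]
    _ = F * simpleElem α₂ P₂ z * (F⁻¹ * F) * simpleElem α₁ P₁ z * F⁻¹ := by
        rw [key, nonsing_inv_mul _ hF, mul_one, ← mul_assoc]
    _ = _ := by simp only [mul_assoc]

lemma simpleElem_self_mul (α : ℂ) {P : Matrix (Fin n) (Fin n) ℂ} (hP : P * P = P) :
    simpleElem α P α * P = 0 := by
  simp only [simpleElem, add_mul, smul_mul_assoc, one_mul, hP]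
  module

lemma mul_eq_of_isUnit_mul_simpleElem {α : ℂ} (hα : α.im ≠ 0)
    {P Q M N : Matrix (Fin n) (Fin n) ℂ} (hP : P * P = P) (hN : IsUnit N)
    (h : M * simpleElem α P α = N * simpleElem α Q α) : Q * P = P := by
  have h0 : N * (simpleElem α Q α * P) = N * 0 := by
    rw [← mul_assoc, ← h, mul_assoc, simpleElem_self_mul α hP, mul_zero, mul_zero]
  have h1 := hN.mul_left_cancel h0
  have hne : α - star α ≠ 0 := by
    intro e
    have := congrArg Complex.im e
    simp only [Complex.sub_im, Complex.star_def, Complex.conj_im, Complex.zero_im] at this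
    exact hα (by linarith)
  have h2 : (α - star α) • (P - Q * P) = 0 := by
    rw [← h1, simpleElem, add_mul, smul_mul_assoc, smul_mul_assoc, one_mul]
    module
  exact (sub_eq_zero.mp ((smul_eq_zero.mp h2).resolve_left hne)).symm

/-- The kernel of the rightmost factor at `z = α` determines its projector. -/
lemma IsHermProj.eq_of_mul_simpleElem {α : ℂ} (hα : α.im ≠ 0)
    {P Q M N : Matrix (Fin n) (Fin n) ℂ} (hP : IsHermProj P) (hQ : IsHermProj Q)
    (hM : IsUnit M) (hN : IsUnit N)
    (h : M * simpleElem α P α = N * simpleElem α Q α) : P = Q := by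
  have h1 := mul_eq_of_isUnit_mul_simpleElem hα hP.2 hN h
  have h2 := congrArg conjTranspose (mul_eq_of_isUnit_mul_simpleElem hα hQ.2 hM h.symm)
  rw [conjTranspose_mul, hP.1, hQ.1] at h2
  exact h1.symm.trans h2

/-- Uniqueness of the factorization of a product of three simple elements. -/
lemma simpleElem_mul_unique {α₁ α₂ α₃ : ℂ}
    (h₁ : α₁.im ≠ 0) (h₂ : α₂.im ≠ 0) (h₃ : α₃.im ≠ 0)
    (h₁₂ : IsGeneric α₁ α₂) (h₁₃ : IsGeneric α₁ α₃) (h₂₃ : IsGeneric α₂ α₃)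
    {P₁ P₂ P₃ Q₁ Q₂ Q₃ : Matrix (Fin n) (Fin n) ℂ}
    (hP₁ : IsHermProj P₁) (hP₂ : IsHermProj P₂) (hP₃ : IsHermProj P₃)
    (hQ₁ : IsHermProj Q₁) (hQ₂ : IsHermProj Q₂) (hQ₃ : IsHermProj Q₃)
    (h : ∀ z, simpleElem α₃ P₃ z * simpleElem α₂ P₂ z * simpleElem α₁ P₁ z
      = simpleElem α₃ Q₃ z * simpleElem α₂ Q₂ z * simpleElem α₁ Q₁ z) :
    P₁ = Q₁ ∧ P₂ = Q₂ ∧ P₃ = Q₃ := by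
  obtain rfl : P₁ = Q₁ := hP₁.eq_of_mul_simpleElem h₁ hQ₁
    ((isUnit_simpleElem h₁₃ hP₃.2).mul (isUnit_simpleElem h₁₂ hP₂.2))
    ((isUnit_simpleElem h₁₃ hQ₃.2).mul (isUnit_simpleElem h₁₂ hQ₂.2)) (h α₁)
  obtain rfl : P₂ = Q₂ := hP₂.eq_of_mul_simpleElem h₂ hQ₂
    (isUnit_simpleElem h₂₃ hP₃.2) (isUnit_simpleElem h₂₃ hQ₃.2)
    ((isUnit_simpleElem h₁₂.symm hP₁.2).mul_right_cancel (h α₂))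
  refine ⟨rfl, rfl, hP₃.eq_of_mul_simpleElem h₃ hQ₃ isUnit_one isUnit_one ?_⟩
  rw [one_mul, one_mul]
  exact (isUnit_simpleElem h₂₃.symm hP₂.2).mul_right_cancel
    ((isUnit_simpleElem h₁₃.symm hP₁.2).mul_right_cancel (h α₃))

end RefactorizationMaps

/-- The parametric Yang–Baxter equation for the refactorization maps on triples of
Hermitian projectors. -/
theorem parametric_yang_baxter {n : ℕ} (α₁ α₂ α₃ : ℂ)
    (h₁ : α₁.im ≠ 0) (h₂ : α₂.im ≠ 0) (h₃ : α₃.im ≠ 0)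
    (h₁₂ : ({α₁, star α₁} : Set ℂ) ∩ {α₂, star α₂} = ∅)
    (h₁₃ : ({α₁, star α₁} : Set ℂ) ∩ {α₃, star α₃} = ∅)
    (h₂₃ : ({α₂, star α₂} : Set ℂ) ∩ {α₃, star α₃} = ∅)
    (P₁ P₂ P₃ : Matrix (Fin n) (Fin n) ℂ)
    (hP₁ : P₁ᴴ = P₁) (hP₁2 : P₁ * P₁ = P₁)
    (hP₂ : P₂ᴴ = P₂) (hP₂2 : P₂ * P₂ = P₂)
    (hP₃ : P₃ᴴ = P₃) (hP₃2 : P₃ * P₃ = P₃) :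
    R12 α₁ α₂ (R13 α₁ α₃ (R23 α₂ α₃ (P₁, P₂, P₃)))
      = R23 α₂ α₃ (R13 α₁ α₃ (R12 α₁ α₂ (P₁, P₂, P₃))) := by
  obtain ⟨a₂, a₃, ea⟩ := Rpair_spec h₂₃ ⟨hP₂, hP₂2⟩ ⟨hP₃, hP₃2⟩
  obtain ⟨b₁, b₃, eb⟩ := Rpair_spec h₁₃ ⟨hP₁, hP₁2⟩ a₃
  obtain ⟨c₁, c₂, ec⟩ := Rpair_spec h₁₂ b₁ a₂
  obtain ⟨d₁, d₂, ed⟩ := Rpair_spec h₁₂ ⟨hP₁, hP₁2⟩ ⟨hP₂, hP₂2⟩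
  obtain ⟨e₁, e₃, ee⟩ := Rpair_spec h₁₃ d₁ ⟨hP₃, hP₃2⟩
  obtain ⟨f₂, f₃, ef⟩ := Rpair_spec h₂₃ d₂ e₃
  obtain ⟨r₁, r₂, r₃⟩ := simpleElem_mul_unique h₁ h₂ h₃ h₁₂ h₁₃ h₂₃ c₁ c₂ b₃ e₁ f₂ f₃ fun z => by
    rw [mul_assoc, ← ec, ← mul_assoc, ← eb, mul_assoc, ← ea, ← ef, mul_assoc, ← ee, ← mul_assoc,
      ← mul_assoc, ← ed]
  exact Prod.ext r₁ (Prod.ext r₂ r₃)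
end
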